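/- Let q ∈ (1, 2), let p = q/(q−1) be its Hölder conjugate, and let γ > 0 satisfy γ(q−1) ≤ 1 and n + γ(q−1) − 1 > 0. There exists a constant C > 0 such that for every ε ∈ (0, 1] and every smooth compactly supported f: ℝⁿ × ℝᵐ → ℝ, ∫ |f|^q dμ ≤ C ( ε ∫ |∇_γ f|^q dμ + ε^{−γ} ∫ |x|^{γq} |f|^q dμ ). -/

import Mathlib

open MeasureTheory

/-- The Grushin Kaplan norm `N(x,y) = (|x|^{2(1+γ)} + (1+γ)²|y|²)^{1/(2+2γ)}` on `ℝⁿ × ℝᵐ`. -/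
noncomputable def GKaplan (n m : ℕ) (γ : ℝ)
    (w : EuclideanSpace ℝ (Fin n) × EuclideanSpace ℝ (Fin m)) : ℝ :=
  (‖w.1‖ ^ (2 * (1 + γ)) + (1 + γ) ^ 2 * ‖w.2‖ ^ 2) ^ (1 / (2 + 2 * γ))

/-- Partial derivative `∂_{x_i} f` in the `i`-th coordinate of the `x`-variable. -/
noncomputable def dX (n m : ℕ)
    (f : EuclideanSpace ℝ (Fin n) × EuclideanSpace ℝ (Fin m) → ℝ)
    (w : EuclideanSpace ℝ (Fin n) × EuclideanSpace ℝ (Fin m)) (i : Fin n) : ℝ :=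
  fderiv ℝ f w (EuclideanSpace.single i (1 : ℝ), 0)

/-- Partial derivative `∂_{y_j} f` in the `j`-th coordinate of the `y`-variable. -/
noncomputable def dY (n m : ℕ)
    (f : EuclideanSpace ℝ (Fin n) × EuclideanSpace ℝ (Fin m) → ℝ)
    (w : EuclideanSpace ℝ (Fin n) × EuclideanSpace ℝ (Fin m)) (j : Fin m) : ℝ :=
  fderiv ℝ f w (0, EuclideanSpace.single j (1 : ℝ))

/-- The squared length of the Grushin subgradient:
`|∇_γ f|² = |∇_x f|² + |x|^{2γ} |∇_y f|²`. -/
noncomputable def gradSqG (n m : ℕ) (γ : ℝ)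
    (f : EuclideanSpace ℝ (Fin n) × EuclideanSpace ℝ (Fin m) → ℝ)
    (w : EuclideanSpace ℝ (Fin n) × EuclideanSpace ℝ (Fin m)) : ℝ :=
  (∑ i, (dX n m f w i) ^ 2) + ‖w.1‖ ^ (2 * γ) * ∑ j, (dY n m f w j) ^ 2

/-- The probability measure `dμ = Z⁻¹ e^{-N^p} dξ` on `ℝⁿ × ℝᵐ` in the Grushin setting. -/
noncomputable def muG (n m : ℕ) (γ p : ℝ) :
    Measure (EuclideanSpace ℝ (Fin n) × EuclideanSpace ℝ (Fin m)) :=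
  volume.withDensity (fun w => ENNReal.ofReal
    ((∫ v : EuclideanSpace ℝ (Fin n) × EuclideanSpace ℝ (Fin m),
        Real.exp (-(GKaplan n m γ v) ^ p))⁻¹ * Real.exp (-(GKaplan n m γ w) ^ p)))

lemma young_aux {X G l q : ℝ} (hX : 0 ≤ X) (hG : 0 ≤ G) (hl : 0 < l) (hq : 1 < q) :
    X ^ (q - 1) * G ≤ l ^ (q - 1) * G ^ q + l⁻¹ * X ^ q := by
  have h1 : ∀ z : ℝ, 0 ≤ z → z ^ q = z ^ (q - 1) * z := fun z hz => by
    rw [← Real.rpow_add_one' hz (by linarith)]; congr 1; ring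
  have hGq := Real.rpow_nonneg hG q
  have hXq := Real.rpow_nonneg hX q
  rcases le_total X (l * G) with h | h
  · have : X ^ (q - 1) ≤ l ^ (q - 1) * G ^ (q - 1) := by
      rw [← Real.mul_rpow hl.le hG]
      exact Real.rpow_le_rpow hX h (by linarith)
    have h2 : X ^ (q - 1) * G ≤ l ^ (q - 1) * G ^ (q - 1) * G :=
      mul_le_mul_of_nonneg_right this hG
    have h3 : 0 ≤ l⁻¹ * X ^ q := by positivity
    rw [h1 G hG]; linarith
  · have h2 : G ≤ l⁻¹ * X := by
      rw [inv_mul_eq_div, le_div_iff₀ hl]; linarith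
    have h3 : X ^ (q - 1) * G ≤ X ^ (q - 1) * (l⁻¹ * X) :=
      mul_le_mul_of_nonneg_left h2 (Real.rpow_nonneg hX _)
    have h4 : 0 ≤ l ^ (q - 1) * G ^ q := by positivity
    rw [h1 X hX]; linarith

theorem integral_comp_dilation {n m : ℕ} (a b : ℝ) (ha : 0 < a) (hb : 0 < b)
    {u : EuclideanSpace ℝ (Fin n) × EuclideanSpace ℝ (Fin m) → ℝ}
    (hu : Continuous u) (huc : HasCompactSupport u) :
    Integrable (fun w : EuclideanSpace ℝ (Fin n) × EuclideanSpace ℝ (Fin m) =>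
      u (a • w.1, b • w.2)) ∧
    ∫ w : EuclideanSpace ℝ (Fin n) × EuclideanSpace ℝ (Fin m), u (a • w.1, b • w.2) = (a ^ n)⁻¹ * (b ^ m)⁻¹ * ∫ w, u w := by
  have hui : Integrable u := hu.integrable_of_hasCompactSupport huc
  have hci : Integrable (fun w : EuclideanSpace ℝ (Fin n) × EuclideanSpace ℝ (Fin m) =>
      u (a • w.1, b • w.2)) := by
    refine Continuous.integrable_of_hasCompactSupport (by fun_prop) ?_
    exact huc.comp_homeomorph
      ((Homeomorph.smulOfNeZero a ha.ne').prodCongr (Homeomorph.smulOfNeZero b hb.ne'))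
  refine ⟨hci, ?_⟩
  rw [Measure.volume_eq_prod] at hci hui ⊢
  rw [integral_prod _ hci, integral_prod _ hui]
  have h1 : ∀ x : EuclideanSpace ℝ (Fin n),
      ∫ y : EuclideanSpace ℝ (Fin m), u (a • x, b • y) =
        (b ^ m)⁻¹ * ∫ y : EuclideanSpace ℝ (Fin m), u (a • x, y) := fun x => by
    have := Measure.integral_comp_smul (volume : Measure (EuclideanSpace ℝ (Fin m)))
      (fun y => u (a • x, y)) b
    rw [this, finrank_euclideanSpace_fin, abs_of_pos (by positivity), smul_eq_mul]
  simp only [h1]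
  rw [integral_const_mul]
  have := Measure.integral_comp_smul (volume : Measure (EuclideanSpace ℝ (Fin n)))
      (fun x => ∫ y : EuclideanSpace ℝ (Fin m), u (x, y)) a
  rw [this, finrank_euclideanSpace_fin, abs_of_pos (by positivity), smul_eq_mul]
  ring

theorem integral_deriv_flow {n m : ℕ} (α κ : ℝ)
    {u u' H : EuclideanSpace ℝ (Fin n) × EuclideanSpace ℝ (Fin m) → ℝ}
    (hu : Continuous u) (huc : HasCompactSupport u) (hu' : Measurable u')
    (hH : Continuous H) (hHc : HasCompactSupport H) (hb : ∀ w, |u' w| ≤ H w)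
    (hd : ∀ w, HasDerivAt (fun s : ℝ => u (Real.exp (α * s) • w.1, Real.exp (κ * s) • w.2))
      (u' w) 0) :
    Integrable u' ∧ ∫ w, u' w = -(α * n + κ * m) * ∫ w, u w := by
  obtain ⟨B, hB⟩ := hHc.exists_bound_of_continuous hH
  obtain ⟨R, hR⟩ := hHc.isCompact.isBounded.subset_closedBall 0
  have hR' : ∀ w, u' w ≠ 0 → ‖w‖ ≤ R := fun w hw => by
    have hHw : H w ≠ 0 := fun h => hw (abs_nonpos_iff.1 (h ▸ hb w))
    simpa using hR (subset_tsupport H hHw)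
  have hB' : ∀ w, |u' w| ≤ B := fun w => (hb w).trans ((le_abs_self _).trans (hB w))
  have hB0 : 0 ≤ B := (abs_nonneg _).trans (hB' 0)
  set M := max (Real.exp |α|) (Real.exp |κ|) with hM
  have hMpos : 0 ≤ M := (Real.exp_pos _).le.trans (le_max_left _ _)
  set bound : EuclideanSpace ℝ (Fin n) × EuclideanSpace ℝ (Fin m) → ℝ :=
    (Metric.closedBall 0 (M * R)).indicator (fun _ => B) with hbound
  have hscale : ∀ (c s : ℝ), |s| < 1 → ∀ {k : ℕ} (z : EuclideanSpace ℝ (Fin k)),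
      ‖z‖ ≤ Real.exp |c| * ‖Real.exp (c * s) • z‖ := fun c s hs k z => by
    rw [norm_smul, Real.norm_eq_abs, Real.abs_exp, ← mul_assoc, ← Real.exp_add]
    refine le_mul_of_one_le_left (norm_nonneg _) (Real.one_le_exp ?_)
    have h1 : |c * s| ≤ |c| := by
      rw [abs_mul]; exact mul_le_of_le_one_right (abs_nonneg _) hs.le
    linarith [neg_abs_le (c * s)]
  have key := hasDerivAt_integral_of_dominated_loc_of_deriv_le (μ := volume) (𝕜 := ℝ)
    (F := fun (s : ℝ) (w : EuclideanSpace ℝ (Fin n) × EuclideanSpace ℝ (Fin m)) =>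
      u (Real.exp (α * s) • w.1, Real.exp (κ * s) • w.2))
    (F' := fun s w => u' (Real.exp (α * s) • w.1, Real.exp (κ * s) • w.2))
    (x₀ := (0 : ℝ)) (s := Metric.ball 0 1) (bound := bound)
    (Metric.ball_mem_nhds _ one_pos)
    (Filter.Eventually.of_forall fun s =>
      (show Continuous _ by fun_prop).aestronglyMeasurable)
    (integral_comp_dilation _ _ (Real.exp_pos _) (Real.exp_pos _) hu huc).1
    (by simpa using hu'.aestronglyMeasurable)
    (Filter.Eventually.of_forall fun w s hs => by
      rw [Metric.mem_ball, dist_zero_right, Real.norm_eq_abs] at hs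
      by_cases h0 : u' (Real.exp (α * s) • w.1, Real.exp (κ * s) • w.2) = 0
      · rw [h0, norm_zero]
        exact Set.indicator_nonneg (fun _ _ => hB0) _
      · have hn := hR' _ h0
        rw [Prod.norm_mk, max_le_iff] at hn
        have hw : w ∈ Metric.closedBall (0 : EuclideanSpace ℝ (Fin n) × EuclideanSpace ℝ (Fin m))
            (M * R) := by
          rw [mem_closedBall_zero_iff, Prod.norm_def, max_le_iff]
          exact ⟨(hscale α s hs _).trans
              (mul_le_mul (le_max_left _ _) hn.1 (norm_nonneg _) hMpos),
            (hscale κ s hs _).trans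
              (mul_le_mul (le_max_right _ _) hn.2 (norm_nonneg _) hMpos)⟩
        rw [hbound, Set.indicator_of_mem hw]
        exact hB' _)
    ((integrable_indicator_iff measurableSet_closedBall).2
      (integrableOn_const (isCompact_closedBall _ _).measure_lt_top.ne))
    (Filter.Eventually.of_forall fun w s _ => by
      have h := hd (Real.exp (α * s) • w.1, Real.exp (κ * s) • w.2)
      have h' := HasDerivAt.comp_sub_const (f := fun t : ℝ => u (Real.exp (α * t) •
        (Real.exp (α * s) • w.1), Real.exp (κ * t) • (Real.exp (κ * s) • w.2))) s s
        (by rw [sub_self]; exact h)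
      refine h'.congr_of_eventuallyEq (Filter.Eventually.of_forall fun t => ?_)
      simp only [smul_smul, ← Real.exp_add]
      ring_nf)
  have hval : ∀ s : ℝ, ∫ w : EuclideanSpace ℝ (Fin n) × EuclideanSpace ℝ (Fin m),
      u (Real.exp (α * s) • w.1, Real.exp (κ * s) • w.2) =
      Real.exp (-(α * n + κ * m) * s) * ∫ w, u w := fun s => by
    rw [(integral_comp_dilation _ _ (Real.exp_pos _) (Real.exp_pos _) hu huc).2,
      ← Real.exp_nat_mul, ← Real.exp_nat_mul, ← Real.exp_neg, ← Real.exp_neg, ← Real.exp_add]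
    congr 2; ring
  have h2 : HasDerivAt (fun s : ℝ => Real.exp (-(α * n + κ * m) * s) * ∫ w, u w)
      (-(α * n + κ * m) * ∫ w, u w) 0 := by
    have := (((hasDerivAt_id (0 : ℝ)).const_mul (-(α * n + κ * m))).exp).mul_const (∫ w, u w)
    simpa using this
  have h1 := key.2
  simp only [hval] at h1
  refine ⟨by simpa using key.1, ?_⟩
  simpa using h1.unique h2

lemma sq_apply_le {k : ℕ} (L : EuclideanSpace ℝ (Fin k) →L[ℝ] ℝ) (x : EuclideanSpace ℝ (Fin k)) :
    (L x) ^ 2 ≤ ‖x‖ ^ 2 * ∑ i, (L (EuclideanSpace.single i 1)) ^ 2 := by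
  have hx : L x = ∑ i, x i * L (EuclideanSpace.single i 1) := by
    conv_lhs => rw [← (EuclideanSpace.basisFun (Fin k) ℝ).sum_repr x]
    simp
  rw [hx, EuclideanSpace.real_norm_sq_eq]
  exact Finset.sum_mul_sq_le_sq_mul_sq _ _ _

lemma hardy_pointwise {r A F G T δ γ q α β P N l : ℝ} (hr : 0 ≤ r) (hA : r ^ (2 + 2 * γ) ≤ A)
    (hF : 0 ≤ F) (hG : 0 ≤ G) (hT : |T| ≤ q * F ^ (q - 1) * (r * G)) (hδ : 0 < δ) (hγ : 0 < γ)
    (hq : 1 < q) (hβ : β = γ * (q - 1) - 1) (hβ0 : β ≤ 0) (hP : 0 ≤ P) (hl : 0 < l) :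
    (N + β) * (F ^ q * (r ^ 2 + δ ^ 2) ^ (β / 2)) ≤
      T * (r ^ 2 + δ ^ 2) ^ (β / 2) + F ^ q * (β * r ^ 2 * (r ^ 2 + δ ^ 2) ^ (β / 2 - 1))
      - P * (F ^ q * (r ^ 2 + δ ^ 2) ^ (β / 2) * (A ^ (α - 1) * r ^ (2 + 2 * γ)))
      + N * (F ^ q * (r ^ 2 + δ ^ 2) ^ (β / 2))
      + q * (l ^ (q - 1) * G ^ q + l⁻¹ * (F ^ q * r ^ (γ * q)))
      + P * (l ^ (q - 1) * (F ^ q * (r ^ (γ * q) * A ^ ((α - 1 / 2) * q)))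
        + l⁻¹ * (F ^ q * r ^ (γ * q))) := by
  set B := r ^ 2 + δ ^ 2 with hB
  have hB0 : 0 < B := by positivity
  set k := B ^ (β / 2) with hk
  have hk0 : 0 ≤ k := Real.rpow_nonneg hB0.le _
  have hFq : 0 ≤ F ^ q := Real.rpow_nonneg hF _
  have hb0 : 0 ≤ r ^ (2 + 2 * γ) := Real.rpow_nonneg hr _
  have hA0 : 0 ≤ A := hb0.trans hA
  have hXq : F ^ q * r ^ (γ * q) = (r ^ γ * F) ^ q := by
    rw [Real.mul_rpow (Real.rpow_nonneg hr _) hF, ← Real.rpow_mul hr, mul_comm]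
  have hX0 : 0 ≤ r ^ γ * F := by positivity
  have hk' : β * k ≤ β * r ^ 2 * B ^ (β / 2 - 1) := by
    have h1 : r ^ 2 * B ^ (β / 2 - 1) ≤ k := by
      rw [Real.rpow_sub_one hB0.ne', ← mul_div_assoc, div_le_iff₀ hB0, mul_comm]
      exact mul_le_mul_of_nonneg_left (by rw [hB]; nlinarith [sq_nonneg δ]) hk0
    rw [mul_assoc]
    exact mul_le_mul_of_nonpos_left h1 hβ0
  have hkr : 0 < r → k ≤ r ^ β := fun h => by
    have h1 : k ≤ (r ^ 2) ^ (β / 2) :=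
      Real.rpow_le_rpow_of_nonpos (by positivity) (by rw [hB]; nlinarith [sq_nonneg δ])
        (by linarith)
    rwa [← Real.rpow_natCast, ← Real.rpow_mul hr, Nat.cast_ofNat, mul_div_cancel₀ _ two_ne_zero]
      at h1
  have hrk : r * k ≤ r ^ (γ * (q - 1)) := by
    rcases hr.eq_or_lt with h | h
    · rw [← h, zero_mul]; exact Real.rpow_nonneg le_rfl _
    · have : r * r ^ β = r ^ (γ * (q - 1)) := by
        rw [← Real.rpow_one_add' hr (by rw [hβ]; nlinarith [mul_pos hγ (sub_pos.2 hq)])]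
        congr 1; rw [hβ]; ring
      rw [← this]
      exact mul_le_mul_of_nonneg_left (hkr h) hr
  have hTk : -(q * (l ^ (q - 1) * G ^ q + l⁻¹ * (F ^ q * r ^ (γ * q)))) ≤ T * k := by
    have h1 : |T| * k ≤ q * ((r ^ γ * F) ^ (q - 1) * G) := by
      calc |T| * k ≤ q * F ^ (q - 1) * (r * G) * k := mul_le_mul_of_nonneg_right hT hk0
        _ = q * (F ^ (q - 1) * G) * (r * k) := by ring
        _ ≤ q * (F ^ (q - 1) * G) * r ^ (γ * (q - 1)) :=
          mul_le_mul_of_nonneg_left hrk (by positivity)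
        _ = _ := by
          rw [Real.mul_rpow (Real.rpow_nonneg hr _) hF, ← Real.rpow_mul hr]; ring
    have h2 := mul_le_mul_of_nonneg_left (young_aux hX0 hG hl hq) (by linarith : 0 ≤ q)
    rw [hXq]
    have h3 := mul_le_mul_of_nonneg_right (neg_abs_le T) hk0
    linarith
  have hkA : k * (A ^ (α - 1) * r ^ (2 + 2 * γ)) ≤ r ^ (γ * q) * A ^ (α - 1 / 2) := by
    rcases hr.eq_or_lt with h | h
    · rw [← h, Real.zero_rpow (by linarith : 2 + 2 * γ ≠ 0)]
      have := Real.rpow_nonneg (le_refl (0 : ℝ)) (γ * q)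
      have := Real.rpow_nonneg hA0 (α - 1 / 2)
      simp only [mul_zero]; positivity
    · have hApos : 0 < A := (Real.rpow_pos_of_pos h _).trans_le hA
      have h1 : r ^ (1 + γ) ≤ A ^ (1 / 2 : ℝ) := by
        have := Real.rpow_le_rpow hb0 hA (by norm_num : (0 : ℝ) ≤ 1 / 2)
        rwa [← Real.rpow_mul hr, show (2 + 2 * γ) * (1 / 2) = 1 + γ by ring] at this
      have e1 : r ^ (γ * q) = r ^ β * r ^ (1 + γ) := by
        rw [← Real.rpow_add h]; congr 1; rw [hβ]; ring
      have e2 : A ^ (α - 1 / 2) = A ^ (α - 1) * A ^ (1 / 2 : ℝ) := by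
        rw [← Real.rpow_add hApos]; congr 1; ring
      have e3 : r ^ (2 + 2 * γ) = r ^ (1 + γ) * r ^ (1 + γ) := by
        rw [← Real.rpow_add h]; congr 1; ring
      calc k * (A ^ (α - 1) * r ^ (2 + 2 * γ))
          ≤ r ^ β * (A ^ (α - 1) * (A ^ (1 / 2 : ℝ) * r ^ (1 + γ))) := by
            rw [e3]
            gcongr
            exact hkr h
        _ = _ := by rw [e1, e2]; ring
  have hS : A ^ (α - 1 / 2) ≤ l ^ (q - 1) * A ^ ((α - 1 / 2) * q) + l⁻¹ := by
    have := young_aux zero_le_one (Real.rpow_nonneg hA0 (α - 1 / 2)) hl hq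
    rwa [Real.one_rpow, Real.one_rpow, one_mul, mul_one, ← Real.rpow_mul hA0] at this
  have hPt : P * (F ^ q * k * (A ^ (α - 1) * r ^ (2 + 2 * γ))) ≤
      P * (l ^ (q - 1) * (F ^ q * (r ^ (γ * q) * A ^ ((α - 1 / 2) * q)))
        + l⁻¹ * (F ^ q * r ^ (γ * q))) := by
    refine mul_le_mul_of_nonneg_left ?_ hP
    calc F ^ q * k * (A ^ (α - 1) * r ^ (2 + 2 * γ))
        = F ^ q * (k * (A ^ (α - 1) * r ^ (2 + 2 * γ))) := by ring
      _ ≤ F ^ q * (r ^ (γ * q) * (l ^ (q - 1) * A ^ ((α - 1 / 2) * q) + l⁻¹)) := by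
        refine mul_le_mul_of_nonneg_left (hkA.trans ?_) hFq
        exact mul_le_mul_of_nonneg_left hS (Real.rpow_nonneg hr _)
      _ = _ := by ring
  have h5 := mul_le_mul_of_nonneg_left hk' hFq
  linarith

lemma dilation_pointwise {r A F G D T γ q α σ l : ℝ} (hr : 0 ≤ r) (hA : 0 ≤ A)
    (hF : 0 ≤ F) (hG : 0 ≤ G) (hT : |T| ≤ q * F ^ (q - 1) * |D|)
    (hD : r ^ γ * |D| ≤ 2 * A ^ (1 / 2 : ℝ) * G) (hγ : 0 < γ)
    (hq : 1 < q) (hα : α * (q - 1) / q + σ / q = 1 / 2) (hσ : 0 ≤ σ) (hl : 0 < l) :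
    T * (r ^ (γ * q) * (1 + A) ^ (-σ)) ≤
      2 * q * (l ^ (q - 1) * G ^ q + l⁻¹ * (F ^ q * (r ^ (γ * q) * (A ^ α * (1 + A) ^ (-σ))))) := by
  have hA1 : 0 < 1 + A := by linarith
  have hq0 : 0 < q := by linarith
  set E := A ^ α * (1 + A) ^ (-σ) with hE
  have hE0 : 0 ≤ E := by positivity
  have hX0 : 0 ≤ r ^ γ * F * E ^ (1 / q) := by positivity
  have hXq : F ^ q * (r ^ (γ * q) * E) = (r ^ γ * F * E ^ (1 / q)) ^ q := by
    rw [Real.mul_rpow (by positivity) (by positivity), Real.mul_rpow (by positivity) hF,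
      ← Real.rpow_mul hr, ← Real.rpow_mul hE0, one_div_mul_cancel hq0.ne', Real.rpow_one]
    ring
  have hEA : A ^ (1 / 2 : ℝ) * (1 + A) ^ (-σ) ≤ (E ^ (1 / q)) ^ (q - 1) := by
    have e1 : A ^ (1 / 2 : ℝ) = A ^ (α * (q - 1) / q) * A ^ (σ / q) := by
      rw [← Real.rpow_add' hA (by rw [hα]; norm_num), hα]
    have e2 : (E ^ (1 / q)) ^ (q - 1) =
        A ^ (α * (q - 1) / q) * ((1 + A) ^ (σ / q) * (1 + A) ^ (-σ)) := by
      rw [← Real.rpow_mul hE0, hE, Real.mul_rpow (by positivity) (by positivity),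
        ← Real.rpow_mul hA, ← Real.rpow_mul hA1.le, ← Real.rpow_add hA1]
      congr 2
      · ring
      · field_simp; ring
    rw [e1, e2, mul_assoc]
    gcongr
    linarith
  have e3 : r ^ (γ * q) = r ^ (γ * (q - 1)) * r ^ γ := by
    rw [← Real.rpow_add' hr (by nlinarith [mul_pos hγ hq0])]; congr 1; ring
  calc T * (r ^ (γ * q) * (1 + A) ^ (-σ))
      ≤ q * F ^ (q - 1) * |D| * (r ^ (γ * q) * (1 + A) ^ (-σ)) :=
        mul_le_mul_of_nonneg_right ((le_abs_self T).trans hT) (by positivity)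
    _ = q * F ^ (q - 1) * r ^ (γ * (q - 1)) * (1 + A) ^ (-σ) * (r ^ γ * |D|) := by rw [e3]; ring
    _ ≤ q * F ^ (q - 1) * r ^ (γ * (q - 1)) * (1 + A) ^ (-σ) * (2 * A ^ (1 / 2 : ℝ) * G) :=
        mul_le_mul_of_nonneg_left hD (by positivity)
    _ = 2 * q * (F ^ (q - 1) * r ^ (γ * (q - 1)) * G) * (A ^ (1 / 2 : ℝ) * (1 + A) ^ (-σ)) := by
        ring
    _ ≤ 2 * q * (F ^ (q - 1) * r ^ (γ * (q - 1)) * G) * (E ^ (1 / q)) ^ (q - 1) :=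
        mul_le_mul_of_nonneg_left hEA (by positivity)
    _ = 2 * q * ((r ^ γ * F * E ^ (1 / q)) ^ (q - 1) * G) := by
        rw [Real.mul_rpow (x := r ^ γ * F) (by positivity) (by positivity),
          Real.mul_rpow (by positivity) hF, ← Real.rpow_mul hr]
        ring
    _ ≤ _ := by
        rw [hXq]
        exact mul_le_mul_of_nonneg_left (young_aux hX0 hG hl hq) (by positivity)

lemma rpow_le_one_add {A α σ : ℝ} (hA : 0 ≤ A) (hσ : 0 ≤ σ) (hασ : σ ≤ α) :
    A ^ (α - σ) ≤ 1 + 2 ^ σ * (A ^ α * (1 + A) ^ (-σ)) := by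
  rcases le_total A 1 with h | h
  · have := Real.rpow_le_one hA h (sub_nonneg.2 hασ)
    have : 0 ≤ 2 ^ σ * (A ^ α * (1 + A) ^ (-σ)) := by positivity
    linarith
  · have hA0 : 0 < A := by linarith
    have h1 : (2 * A) ^ (-σ) ≤ (1 + A) ^ (-σ) :=
      Real.rpow_le_rpow_of_nonpos (by linarith) (by linarith) (by linarith)
    have h2 : A ^ (α - σ) = 2 ^ σ * (A ^ α * (2 * A) ^ (-σ)) := by
      rw [Real.mul_rpow two_pos.le hA, sub_eq_add_neg, Real.rpow_add hA0,
        Real.rpow_neg two_pos.le]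
      field_simp
    have h3 : 2 ^ σ * (A ^ α * (2 * A) ^ (-σ)) ≤ 2 ^ σ * (A ^ α * (1 + A) ^ (-σ)) := by gcongr
    linarith

lemma le_smoothed_add {r F δ γ q β : ℝ} (hr : 0 ≤ r) (hF : 0 ≤ F) (hδ : 0 < δ) (hγ : 0 < γ)
    (hq : 1 < q) (hβ0 : β ≤ 0) :
    F ^ q ≤ 2 ^ (-(β / 2)) * δ ^ (-β) * (F ^ q * (r ^ 2 + δ ^ 2) ^ (β / 2)) +
      δ ^ (-(γ * q)) * (F ^ q * r ^ (γ * q)) := by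
  have hFq : 0 ≤ F ^ q := Real.rpow_nonneg hF _
  rcases le_total r δ with h | h
  · have h1 : (2 * δ ^ 2) ^ (β / 2) ≤ (r ^ 2 + δ ^ 2) ^ (β / 2) :=
      Real.rpow_le_rpow_of_nonpos (by positivity) (by nlinarith) (by linarith)
    have h2 : (2 * δ ^ 2) ^ (β / 2) = 2 ^ (β / 2) * δ ^ β := by
      rw [Real.mul_rpow two_pos.le (by positivity), ← Real.rpow_natCast, ← Real.rpow_mul hδ.le,
        Nat.cast_ofNat, mul_div_cancel₀ _ two_ne_zero]
    have h3 : 2 ^ (-(β / 2)) * δ ^ (-β) * (F ^ q * (2 * δ ^ 2) ^ (β / 2)) = F ^ q := by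
      rw [h2, Real.rpow_neg two_pos.le, Real.rpow_neg hδ.le]
      field_simp
    have h4 : 2 ^ (-(β / 2)) * δ ^ (-β) * (F ^ q * (2 * δ ^ 2) ^ (β / 2)) ≤
      2 ^ (-(β / 2)) * δ ^ (-β) * (F ^ q * (r ^ 2 + δ ^ 2) ^ (β / 2)) := by gcongr
    have : 0 ≤ δ ^ (-(γ * q)) * (F ^ q * r ^ (γ * q)) := by positivity
    linarith
  · have h1 : δ ^ (γ * q) ≤ r ^ (γ * q) := Real.rpow_le_rpow hδ.le h (by positivity)
    have h2 : F ^ q = δ ^ (-(γ * q)) * (F ^ q * δ ^ (γ * q)) := by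
      rw [Real.rpow_neg hδ.le]; field_simp
    have h3 : δ ^ (-(γ * q)) * (F ^ q * δ ^ (γ * q)) ≤ δ ^ (-(γ * q)) * (F ^ q * r ^ (γ * q)) := by
      gcongr
    have : 0 ≤ 2 ^ (-(β / 2)) * δ ^ (-β) * (F ^ q * (r ^ 2 + δ ^ 2) ^ (β / 2)) := by positivity
    linarith

section Grushin

variable {n m : ℕ} {γ : ℝ} {f : EuclideanSpace ℝ (Fin n) × EuclideanSpace ℝ (Fin m) → ℝ}

/-- The quantity `|x|^{2+2γ} + (1+γ)²|y|²`, of which the Kaplan norm is a power. -/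
noncomputable def gaugePow (γ : ℝ)
    (w : EuclideanSpace ℝ (Fin n) × EuclideanSpace ℝ (Fin m)) : ℝ :=
  ‖w.1‖ ^ (2 + 2 * γ) + (1 + γ) ^ 2 * ‖w.2‖ ^ 2

lemma gaugePow_nonneg (w : EuclideanSpace ℝ (Fin n) × EuclideanSpace ℝ (Fin m)) :
    0 ≤ gaugePow γ w := by
  unfold gaugePow; positivity

lemma norm_fst_rpow_le_gaugePow (w : EuclideanSpace ℝ (Fin n) × EuclideanSpace ℝ (Fin m)) :
    ‖w.1‖ ^ (2 + 2 * γ) ≤ gaugePow γ w := by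
  unfold gaugePow; linarith [show 0 ≤ (1 + γ) ^ 2 * ‖w.2‖ ^ 2 by positivity]

lemma continuous_gaugePow (hγ : 0 < γ) :
    Continuous (gaugePow γ : EuclideanSpace ℝ (Fin n) × EuclideanSpace ℝ (Fin m) → ℝ) := by
  unfold gaugePow
  exact ((continuous_norm.comp continuous_fst).rpow_const fun _ => Or.inr (by linarith)).add
    (by fun_prop)

lemma GKaplan_rpow (p : ℝ) (w : EuclideanSpace ℝ (Fin n) × EuclideanSpace ℝ (Fin m)) :
    (GKaplan n m γ w) ^ p = gaugePow γ w ^ (p / (2 + 2 * γ)) := by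
  have h : GKaplan n m γ w = gaugePow γ w ^ (1 / (2 + 2 * γ)) := by
    unfold GKaplan gaugePow; ring_nf
  rw [h, ← Real.rpow_mul (gaugePow_nonneg w)]
  congr 1; ring

lemma gradSqG_nonneg (w : EuclideanSpace ℝ (Fin n) × EuclideanSpace ℝ (Fin m)) :
    0 ≤ gradSqG n m γ f w :=
  add_nonneg (Finset.sum_nonneg fun _ _ => sq_nonneg _)
    (mul_nonneg (by positivity) (Finset.sum_nonneg fun _ _ => sq_nonneg _))

lemma continuous_gradSqG (hγ : 0 < γ) (hf : ContDiff ℝ (⊤ : ℕ∞) f) :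
    Continuous (gradSqG n m γ f) := by
  have hf' := hf.continuous_fderiv (by simp)
  unfold gradSqG dX dY
  refine Continuous.add (by fun_prop) (Continuous.mul ?_ (by fun_prop))
  exact (continuous_norm.comp continuous_fst).rpow_const fun _ => Or.inr (by linarith)

lemma hasCompactSupport_gradSqG (hfc : HasCompactSupport f) :
    HasCompactSupport (gradSqG n m γ f) := by
  refine (hfc.fderiv ℝ).mono fun w hw => ?_
  contrapose! hw
  rw [Function.notMem_support] at hw ⊢
  simp [gradSqG, dX, dY, hw]

lemma abs_fderiv_fst_le (w : EuclideanSpace ℝ (Fin n) × EuclideanSpace ℝ (Fin m)) :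
    |fderiv ℝ f w (w.1, 0)| ≤ ‖w.1‖ * √(gradSqG n m γ f w) := by
  refine abs_le_of_sq_le_sq ?_ (by positivity)
  rw [mul_pow, Real.sq_sqrt (gradSqG_nonneg w)]
  have h := sq_apply_le ((fderiv ℝ f w).comp (ContinuousLinearMap.inl ℝ _ _)) w.1
  simp only [ContinuousLinearMap.comp_apply, ContinuousLinearMap.inl_apply] at h
  refine h.trans (mul_le_mul_of_nonneg_left ?_ (sq_nonneg _))
  exact le_add_of_nonneg_right
    (mul_nonneg (by positivity) (Finset.sum_nonneg fun _ _ => sq_nonneg _))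

lemma rpow_mul_abs_fderiv_snd_le (w : EuclideanSpace ℝ (Fin n) × EuclideanSpace ℝ (Fin m)) :
    ‖w.1‖ ^ γ * |fderiv ℝ f w (0, w.2)| ≤ ‖w.2‖ * √(gradSqG n m γ f w) := by
  rw [← abs_of_nonneg (show 0 ≤ ‖w.1‖ ^ γ by positivity), ← abs_mul]
  refine abs_le_of_sq_le_sq ?_ (by positivity)
  rw [mul_pow, mul_pow, Real.sq_sqrt (gradSqG_nonneg w)]
  have h := sq_apply_le ((fderiv ℝ f w).comp (ContinuousLinearMap.inr ℝ _ _)) w.2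
  simp only [ContinuousLinearMap.comp_apply, ContinuousLinearMap.inr_apply] at h
  have e : (‖w.1‖ ^ γ) ^ 2 = ‖w.1‖ ^ (2 * γ) := by
    rw [← Real.rpow_natCast, ← Real.rpow_mul (norm_nonneg _), mul_comm]; norm_num
  rw [e]
  calc _ ≤ ‖w.1‖ ^ (2 * γ) * (‖w.2‖ ^ 2 * ∑ j, (dY n m f w j) ^ 2) :=
        mul_le_mul_of_nonneg_left h (by positivity)
    _ = ‖w.2‖ ^ 2 * (‖w.1‖ ^ (2 * γ) * ∑ j, (dY n m f w j) ^ 2) := by ring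
    _ ≤ _ := mul_le_mul_of_nonneg_left
        (le_add_of_nonneg_left (Finset.sum_nonneg fun _ _ => sq_nonneg _)) (sq_nonneg _)

lemma rpow_mul_abs_fderiv_dilation_le (hγ : 0 < γ)
    (w : EuclideanSpace ℝ (Fin n) × EuclideanSpace ℝ (Fin m)) :
    ‖w.1‖ ^ γ * |fderiv ℝ f w (w.1, (1 + γ) • w.2)| ≤
      2 * gaugePow γ w ^ (1 / 2 : ℝ) * √(gradSqG n m γ f w) := by
  set G := √(gradSqG n m γ f w)
  have hG : 0 ≤ G := Real.sqrt_nonneg _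
  have hsplit : fderiv ℝ f w (w.1, (1 + γ) • w.2) =
      fderiv ℝ f w (w.1, 0) + (1 + γ) * fderiv ℝ f w (0, w.2) := by
    rw [← smul_eq_mul, ← map_smul, ← map_add]; simp
  have h1 : ‖w.1‖ ^ γ * ‖w.1‖ ≤ gaugePow γ w ^ (1 / 2 : ℝ) := by
    have := Real.rpow_le_rpow (by positivity) (norm_fst_rpow_le_gaugePow (γ := γ) w)
      (by norm_num : (0 : ℝ) ≤ 1 / 2)
    rwa [← Real.rpow_mul (norm_nonneg _), show (2 + 2 * γ) * (1 / 2) = γ + 1 by ring,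
      Real.rpow_add_one' (norm_nonneg _) (by linarith)] at this
  have h2 : (1 + γ) * ‖w.2‖ ≤ gaugePow γ w ^ (1 / 2 : ℝ) := by
    rw [← Real.sqrt_eq_rpow]
    refine Real.le_sqrt_of_sq_le ?_
    rw [mul_pow]
    exact le_add_of_nonneg_left (by positivity)
  have h3 := abs_add_le (fderiv ℝ f w (w.1, 0)) ((1 + γ) * fderiv ℝ f w (0, w.2))
  rw [abs_mul, abs_of_pos (by linarith : 0 < 1 + γ)] at h3
  rw [hsplit]
  calc _ ≤ ‖w.1‖ ^ γ * (|fderiv ℝ f w (w.1, 0)| + (1 + γ) * |fderiv ℝ f w (0, w.2)|) :=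
        mul_le_mul_of_nonneg_left h3 (by positivity)
    _ = ‖w.1‖ ^ γ * |fderiv ℝ f w (w.1, 0)| +
        (1 + γ) * (‖w.1‖ ^ γ * |fderiv ℝ f w (0, w.2)|) := by ring
    _ ≤ ‖w.1‖ ^ γ * (‖w.1‖ * G) + (1 + γ) * (‖w.2‖ * G) := by
        refine add_le_add (mul_le_mul_of_nonneg_left (abs_fderiv_fst_le w) (by positivity))
          (mul_le_mul_of_nonneg_left (rpow_mul_abs_fderiv_snd_le w) (by linarith))
    _ = (‖w.1‖ ^ γ * ‖w.1‖) * G + ((1 + γ) * ‖w.2‖) * G := by ring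
    _ ≤ gaugePow γ w ^ (1 / 2 : ℝ) * G + gaugePow γ w ^ (1 / 2 : ℝ) * G := by gcongr
    _ = _ := by ring

lemma hasCompactSupport_abs_rpow_mul (hfc : HasCompactSupport f) {s : ℝ} (hs : 0 < s)
    (K : EuclideanSpace ℝ (Fin n) × EuclideanSpace ℝ (Fin m) → ℝ) :
    HasCompactSupport (fun w => |f w| ^ s * K w) :=
  (hfc.comp_left (g := fun t : ℝ => |t| ^ s) (by simp [hs.ne'])).mul_right

lemma integrable_abs_rpow_mul (hf : Continuous f) (hfc : HasCompactSupport f) {s : ℝ} (hs : 0 < s)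
    {K : EuclideanSpace ℝ (Fin n) × EuclideanSpace ℝ (Fin m) → ℝ} (hK : Continuous K) :
    Integrable (fun w => |f w| ^ s * K w) :=
  ((hf.abs.rpow_const fun _ => Or.inr hs.le).mul hK).integrable_of_hasCompactSupport
    (hasCompactSupport_abs_rpow_mul hfc hs K)

lemma continuous_norm_fst_rpow {s : ℝ} (hs : 0 ≤ s) :
    Continuous (fun w : EuclideanSpace ℝ (Fin n) × EuclideanSpace ℝ (Fin m) => ‖w.1‖ ^ s) :=
  (continuous_norm.comp continuous_fst).rpow_const fun _ => Or.inr hs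

lemma continuous_gaugePow_rpow (hγ : 0 < γ) {s : ℝ} (hs : 0 ≤ s) :
    Continuous (fun w : EuclideanSpace ℝ (Fin n) × EuclideanSpace ℝ (Fin m) =>
      gaugePow γ w ^ s) :=
  (continuous_gaugePow hγ).rpow_const fun _ => Or.inr hs

lemma continuous_exp_neg_gaugePow_rpow (hγ : 0 < γ) {s : ℝ} (hs : 0 ≤ s) :
    Continuous (fun w : EuclideanSpace ℝ (Fin n) × EuclideanSpace ℝ (Fin m) =>
      Real.exp (-gaugePow γ w ^ s)) :=
  Real.continuous_exp.comp (continuous_gaugePow_rpow hγ hs).neg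

lemma continuous_one_add_gaugePow_rpow (hγ : 0 < γ) (s : ℝ) :
    Continuous (fun w : EuclideanSpace ℝ (Fin n) × EuclideanSpace ℝ (Fin m) =>
      (1 + gaugePow γ w) ^ s) :=
  (show Continuous fun w : EuclideanSpace ℝ (Fin n) × EuclideanSpace ℝ (Fin m) =>
    1 + gaugePow γ w from continuous_const.add (continuous_gaugePow hγ)).rpow_const fun w =>
    Or.inl (by linarith [gaugePow_nonneg (γ := γ) w] : 0 < 1 + gaugePow γ w).ne'

lemma continuous_smoothed_norm_rpow {δ : ℝ} (hδ : 0 < δ) (s : ℝ) :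
    Continuous (fun w : EuclideanSpace ℝ (Fin n) × EuclideanSpace ℝ (Fin m) =>
      (‖w.1‖ ^ 2 + δ ^ 2) ^ s) :=
  (show Continuous fun w : EuclideanSpace ℝ (Fin n) × EuclideanSpace ℝ (Fin m) =>
    ‖w.1‖ ^ 2 + δ ^ 2 by fun_prop).rpow_const fun w => Or.inl (by positivity)

lemma hasDerivAt_abs_rpow_flow (hf : ContDiff ℝ (⊤ : ℕ∞) f) {q : ℝ} (hq : 1 < q) (a b : ℝ)
    (w : EuclideanSpace ℝ (Fin n) × EuclideanSpace ℝ (Fin m)) :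
    HasDerivAt (fun s : ℝ => |f (Real.exp (a * s) • w.1, Real.exp (b * s) • w.2)| ^ q)
      (q * |f w| ^ (q - 2) * f w * fderiv ℝ f w (a • w.1, b • w.2)) 0 := by
  have hexp : ∀ c : ℝ, HasDerivAt (fun s : ℝ => Real.exp (c * s)) c 0 := fun c => by
    simpa using ((hasDerivAt_id (0 : ℝ)).const_mul c).exp
  have hcurve : HasDerivAt (fun s : ℝ => (Real.exp (a * s) • w.1, Real.exp (b * s) • w.2))
      (a • w.1, b • w.2) 0 := ((hexp a).smul_const w.1).prodMk ((hexp b).smul_const w.2)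
  have h0 : (Real.exp (a * 0) • w.1, Real.exp (b * 0) • w.2) = w := by simp
  have hfd : HasFDerivAt f (fderiv ℝ f w)
      (Real.exp (a * 0) • w.1, Real.exp (b * 0) • w.2) := by
    rw [h0]; exact (hf.differentiable (by simp) w).hasFDerivAt
  have h1 := hfd.comp_hasDerivAt (0 : ℝ) hcurve
  have h2 := (hasDerivAt_abs_rpow (f (Real.exp (a * 0) • w.1, Real.exp (b * 0) • w.2)) hq).comp
    (0 : ℝ) h1
  rw [h0] at h2
  exact h2

lemma abs_deriv_abs_rpow_le {q : ℝ} (hq : 1 < q) (t D : ℝ) :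
    |q * |t| ^ (q - 2) * t * D| ≤ q * |t| ^ (q - 1) * |D| := by
  have h : |t| ^ (q - 2) * |t| ≤ |t| ^ (q - 1) := by
    rcases eq_or_ne t 0 with rfl | ht
    · simp [Real.zero_rpow (sub_pos.2 hq).ne']
    · rw [← Real.rpow_add_one (abs_ne_zero.2 ht)]
      exact (congrArg (|t| ^ ·) (by ring)).le
  rw [abs_mul, abs_mul, abs_mul, abs_of_pos (by linarith : 0 < q),
    abs_of_nonneg (by positivity : 0 ≤ |t| ^ (q - 2)), mul_assoc q]
  gcongr

lemma gaugePow_dilation (w : EuclideanSpace ℝ (Fin n) × EuclideanSpace ℝ (Fin m)) (s : ℝ) :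
    gaugePow γ (Real.exp (1 * s) • w.1, Real.exp ((1 + γ) * s) • w.2) =
      Real.exp ((2 + 2 * γ) * s) * gaugePow γ w := by
  unfold gaugePow
  simp only [norm_smul, Real.norm_eq_abs, Real.abs_exp]
  rw [Real.mul_rpow (Real.exp_pos _).le (norm_nonneg _), ← Real.exp_mul, mul_pow,
    ← Real.exp_nat_mul, mul_add]
  push_cast
  ring_nf

lemma hasDerivAt_exp_mul_zero (c : ℝ) : HasDerivAt (fun s : ℝ => Real.exp (c * s)) c 0 := by
  simpa using ((hasDerivAt_id (0 : ℝ)).const_mul c).exp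

/-- The dilation-invariant weighted bound obtained by integrating along the anisotropic
dilations of the Grushin plane. -/
theorem exists_weighted_bound (n m : ℕ) {q γ α σ : ℝ} (hq : 1 < q) (hγ : 0 < γ)
    (hα : α = q / (q - 1) / (2 + 2 * γ)) (hσ : σ = γ * q / (2 + 2 * γ)) (hσα : σ ≤ α) :
    ∃ C > 0, ∀ f : EuclideanSpace ℝ (Fin n) × EuclideanSpace ℝ (Fin m) → ℝ,
      ContDiff ℝ (⊤ : ℕ∞) f → HasCompactSupport f →
      ∫ w, |f w| ^ q * (‖w.1‖ ^ (γ * q) * gaugePow γ w ^ (α - σ) *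
          Real.exp (-gaugePow γ w ^ α)) ≤
        C * ((∫ w, (gradSqG n m γ f w) ^ (q / 2) * Real.exp (-gaugePow γ w ^ α)) +
          ∫ w, |f w| ^ q * (‖w.1‖ ^ (γ * q) * Real.exp (-gaugePow γ w ^ α))) := by
  have hq0 : 0 < q := by linarith
  have hq1 : 0 < q - 1 := by linarith
  have hc : 0 < 2 + 2 * γ := by linarith
  have hα0 : 0 < α := by rw [hα]; positivity
  have hσ0 : 0 ≤ σ := by rw [hσ]; positivity
  have hγq : 0 < γ * q := by positivity
  have hσc : σ * (2 + 2 * γ) = γ * q := by rw [hσ]; field_simp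
  have hαq : α * (q - 1) / q + σ / q = 1 / 2 := by
    rw [hα, hσ]; field_simp
  set P := α * (2 + 2 * γ) with hP
  have hP0 : 0 < P := by positivity
  set Q : ℝ := 1 * n + (1 + γ) * m with hQ
  have hQ0 : 0 ≤ Q := by positivity
  set l := 4 * q / P with hl
  have hl0 : 0 < l := by positivity
  set a₁ := 2 * q * l ^ (q - 1) with ha₁
  set a₂ := Q + γ * q with ha₂
  have ha₁0 : 0 < a₁ := by positivity
  have ha₂0 : 0 < a₂ := by positivity
  refine ⟨1 + 2 ^ σ * (2 / P) * (a₁ + a₂), by positivity, fun f hf hfc => ?_⟩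
  set A := fun w : EuclideanSpace ℝ (Fin n) × EuclideanSpace ℝ (Fin m) => gaugePow γ w with hA
  have hA0 : ∀ w, 0 ≤ A w := gaugePow_nonneg
  set e := fun w => Real.exp (-A w ^ α) with he
  have he0 : ∀ w, 0 < e w := fun w => Real.exp_pos _
  have he1 : ∀ w, e w ≤ 1 := fun w =>
    Real.exp_le_one_iff.2 (neg_nonpos.2 (Real.rpow_nonneg (hA0 w) _))
  have hec : Continuous e := continuous_exp_neg_gaugePow_rpow hγ hα0.le
  have hRc : Continuous fun w : EuclideanSpace ℝ (Fin n) × EuclideanSpace ℝ (Fin m) =>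
    ‖w.1‖ ^ (γ * q) := continuous_norm_fst_rpow hγq.le
  have hMc : Continuous fun w => (1 + A w) ^ (-σ) := continuous_one_add_gaugePow_rpow hγ _
  have hMc' : Continuous fun w => (1 + A w) ^ (-σ - 1) := continuous_one_add_gaugePow_rpow hγ _
  have hAc : Continuous A := continuous_gaugePow hγ
  have hAαc : Continuous fun w => A w ^ α := continuous_gaugePow_rpow hγ hα0.le
  have hASc : Continuous fun w => A w ^ (α - σ) :=
    continuous_gaugePow_rpow hγ (sub_nonneg.2 hσα)
  have hfq : Continuous fun w => |f w| ^ q :=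
    hf.continuous.abs.rpow_const fun _ => Or.inr hq0.le
  set D := fun w : EuclideanSpace ℝ (Fin n) × EuclideanSpace ℝ (Fin m) =>
    fderiv ℝ f w ((1 : ℝ) • w.1, (1 + γ) • w.2) with hD
  have hDc : Continuous D := (hf.continuous_fderiv (by simp)).clm_apply (by fun_prop)
  set T := fun w => q * |f w| ^ (q - 2) * f w * D w with hT
  have hTm : Measurable T := by
    have := hf.continuous.measurable
    have := hDc.measurable
    fun_prop
  have hTle : ∀ w, |T w| ≤ q * |f w| ^ (q - 1) * |D w| := fun w =>
    abs_deriv_abs_rpow_le hq _ _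
  set u := fun w => |f w| ^ q * (‖w.1‖ ^ (γ * q) * (1 + A w) ^ (-σ) * e w) with hu
  set u' := fun w : EuclideanSpace ℝ (Fin n) × EuclideanSpace ℝ (Fin m) =>
    (T w * (‖w.1‖ ^ (γ * q) * (1 + A w) ^ (-σ))
      + |f w| ^ q * (γ * q * (‖w.1‖ ^ (γ * q) * (1 + A w) ^ (-σ))
        - γ * q * (‖w.1‖ ^ (γ * q) * (A w * (1 + A w) ^ (-σ - 1))))
      - P * (|f w| ^ q * (‖w.1‖ ^ (γ * q) * (A w ^ α * (1 + A w) ^ (-σ))))) * e w with hu'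
  set H := fun w : EuclideanSpace ℝ (Fin n) × EuclideanSpace ℝ (Fin m) =>
    |f w| ^ (q - 1) * (q * |D w| * (‖w.1‖ ^ (γ * q) * (1 + A w) ^ (-σ)) +
      |f w| * ((γ * q + γ * q + P * A w ^ α) * (‖w.1‖ ^ (γ * q) * (1 + A w) ^ (-σ)))) with hH
  have hAM : ∀ w, A w * (1 + A w) ^ (-σ - 1) ≤ (1 + A w) ^ (-σ) := fun w => by
    have h1 : 0 < 1 + A w := by linarith [hA0 w]
    rw [Real.rpow_sub_one h1.ne', ← mul_div_assoc, div_le_iff₀ h1, mul_comm]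
    exact mul_le_mul_of_nonneg_left (by linarith) (Real.rpow_nonneg h1.le _)
  have hbound : ∀ w, |u' w| ≤ H w := fun w => by
    have h1 : 0 < 1 + A w := by linarith [hA0 w]
    have hR0 : 0 ≤ ‖w.1‖ ^ (γ * q) := by positivity
    have hM0 : 0 ≤ (1 + A w) ^ (-σ) := by positivity
    have hAα0 : 0 ≤ A w ^ α := Real.rpow_nonneg (hA0 w) _
    have hAM0 : 0 ≤ A w * (1 + A w) ^ (-σ - 1) := mul_nonneg (hA0 w) (by positivity)
    have hF0 : 0 ≤ |f w| ^ q := by positivity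
    have hFq : |f w| ^ q = |f w| ^ (q - 1) * |f w| := by
      rw [← Real.rpow_add_one' (abs_nonneg _) (by linarith)]; congr 1; ring
    have t1 : |T w * (‖w.1‖ ^ (γ * q) * (1 + A w) ^ (-σ))| ≤
        q * |f w| ^ (q - 1) * |D w| * (‖w.1‖ ^ (γ * q) * (1 + A w) ^ (-σ)) := by
      rw [abs_mul, abs_of_nonneg (mul_nonneg hR0 hM0)]
      exact mul_le_mul_of_nonneg_right (hTle w) (mul_nonneg hR0 hM0)
    have t2 : γ * q * (|f w| ^ q * (‖w.1‖ ^ (γ * q) * (A w * (1 + A w) ^ (-σ - 1)))) ≤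
        γ * q * (|f w| ^ q * (‖w.1‖ ^ (γ * q) * (1 + A w) ^ (-σ))) := by
      gcongr; exact hAM w
    have t3 : 0 ≤ γ * q * (|f w| ^ q * (‖w.1‖ ^ (γ * q) * (A w * (1 + A w) ^ (-σ - 1)))) := by
      positivity
    have t4 : 0 ≤ P * (|f w| ^ q * (‖w.1‖ ^ (γ * q) * (A w ^ α * (1 + A w) ^ (-σ)))) := by
      positivity
    have t5 : 0 ≤ γ * q * (|f w| ^ q * (‖w.1‖ ^ (γ * q) * (1 + A w) ^ (-σ))) := by positivity
    have hHe : H w = q * |f w| ^ (q - 1) * |D w| * (‖w.1‖ ^ (γ * q) * (1 + A w) ^ (-σ)) +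
        2 * (γ * q * (|f w| ^ q * (‖w.1‖ ^ (γ * q) * (1 + A w) ^ (-σ)))) +
        P * (|f w| ^ q * (‖w.1‖ ^ (γ * q) * (A w ^ α * (1 + A w) ^ (-σ)))) := by
      simp only [hH]; rw [hFq]; ring
    rw [hHe]
    simp only [hu']
    rw [abs_mul, abs_of_pos (he0 w)]
    refine (mul_le_of_le_one_right (abs_nonneg _) (he1 w)).trans ?_
    rw [abs_le] at t1 ⊢
    constructor <;> linarith [t1.1, t1.2]
  have hderiv : ∀ w : EuclideanSpace ℝ (Fin n) × EuclideanSpace ℝ (Fin m),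
      HasDerivAt (fun s : ℝ => u (Real.exp (1 * s) • w.1, Real.exp ((1 + γ) * s) • w.2))
        (u' w) 0 := fun w => by
    have d1 := hasDerivAt_abs_rpow_flow hf hq 1 (1 + γ) w
    have d2 := (hasDerivAt_exp_mul_zero (γ * q)).mul_const (‖w.1‖ ^ (γ * q))
    have h1 : 0 < 1 + A w := by linarith [hA0 w]
    have d3 := (((hasDerivAt_exp_mul_zero (2 + 2 * γ)).mul_const (A w)).const_add 1).rpow_const
      (p := -σ) (Or.inl (by simpa using h1.ne'))
    have d4 := ((hasDerivAt_exp_mul_zero P).mul_const (A w ^ α)).neg.exp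
    have d := d1.mul ((d2.mul d3).mul d4)
    have hfun : (fun s : ℝ => u (Real.exp (1 * s) • w.1, Real.exp ((1 + γ) * s) • w.2)) =
        fun s : ℝ => |f (Real.exp (1 * s) • w.1, Real.exp ((1 + γ) * s) • w.2)| ^ q *
          (Real.exp (γ * q * s) * ‖w.1‖ ^ (γ * q) *
            (1 + Real.exp ((2 + 2 * γ) * s) * A w) ^ (-σ) *
            Real.exp (-(Real.exp (P * s) * A w ^ α))) := by
      funext s
      simp only [hu, he, hA]
      rw [gaugePow_dilation, norm_smul, Real.norm_eq_abs, Real.abs_exp,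
        Real.mul_rpow (Real.exp_pos _).le (norm_nonneg _), ← Real.exp_mul,
        Real.mul_rpow (Real.exp_pos _).le (gaugePow_nonneg w), ← Real.exp_mul, hP]
      ring_nf
    rw [hfun]
    refine d.congr_deriv ?_
    simp only [hu', hT, hD, he, Pi.mul_apply, Pi.neg_apply, mul_zero, Real.exp_zero, one_mul, one_smul,
      Prod.mk.eta, ← hσc]
    ring
  obtain ⟨hu'i, hu'eq⟩ := integral_deriv_flow (n := n) (m := m) 1 (1 + γ) (u := u) (u' := u')
    (H := H) (hfq.mul ((hRc.mul hMc).mul hec)) (hasCompactSupport_abs_rpow_mul hfc hq0 _)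
    (by
      have h1 := hRc.measurable
      have h2 := hMc.measurable
      have h3 := hMc'.measurable
      have h4 := hAc.measurable
      have h5 := hfq.measurable
      have h6 := hec.measurable
      have h7 := hAαc.measurable
      simp only [hu']
      fun_prop)
    (((hf.continuous.abs.rpow_const fun _ => Or.inr hq1.le)).mul
      (((continuous_const.mul hDc.abs).mul (hRc.mul hMc)).add
        (hf.continuous.abs.mul ((continuous_const.add (continuous_const.mul hAαc)).mul
          (hRc.mul hMc)))))
    (hasCompactSupport_abs_rpow_mul hfc hq1 _) hbound hderiv
  have hui : Integrable u :=
    integrable_abs_rpow_mul hf.continuous hfc hq0 ((hRc.mul hMc).mul hec)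
  set Y := fun w : EuclideanSpace ℝ (Fin n) × EuclideanSpace ℝ (Fin m) =>
    |f w| ^ q * (‖w.1‖ ^ (γ * q) * (A w ^ α * (1 + A w) ^ (-σ)) * e w) with hY
  set X := fun w : EuclideanSpace ℝ (Fin n) × EuclideanSpace ℝ (Fin m) =>
    |f w| ^ q * (‖w.1‖ ^ (γ * q) * e w) with hX
  set g := fun w => gradSqG n m γ f w ^ (q / 2) * e w with hg
  have hYi : Integrable Y :=
    integrable_abs_rpow_mul hf.continuous hfc hq0 ((hRc.mul (hAαc.mul hMc)).mul hec)
  have hXi : Integrable X := integrable_abs_rpow_mul hf.continuous hfc hq0 (hRc.mul hec)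
  have hgi : Integrable g := by
    refine Continuous.integrable_of_hasCompactSupport
      (((continuous_gradSqG hγ hf).rpow_const fun _ => Or.inr (by linarith)).mul hec) ?_
    exact ((hasCompactSupport_gradSqG hfc).comp_left (g := fun t : ℝ => t ^ (q / 2))
      (Real.zero_rpow (by linarith))).mul_right
  have hpt : ∀ w, u' w + Q * u w ≤ a₁ * g w + (2 * q * l⁻¹ - P) * Y w + a₂ * X w := fun w => by
    have h1 : 0 < 1 + A w := by linarith [hA0 w]
    have hG : √(gradSqG n m γ f w) ^ q = gradSqG n m γ f w ^ (q / 2) := by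
      rw [Real.sqrt_eq_rpow, ← Real.rpow_mul (gradSqG_nonneg w)]; congr 1; ring
    have k1 := dilation_pointwise (r := ‖w.1‖) (A := A w) (F := |f w|) (norm_nonneg _) (hA0 w)
      (abs_nonneg _) (Real.sqrt_nonneg (gradSqG n m γ f w)) (hTle w)
      (by simpa [hD] using rpow_mul_abs_fderiv_dilation_le (f := f) hγ w) hγ hq hαq hσ0 hl0
    rw [hG] at k1
    have k2 : ‖w.1‖ ^ (γ * q) * (1 + A w) ^ (-σ) ≤ ‖w.1‖ ^ (γ * q) :=
      mul_le_of_le_one_right (by positivity)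
        (Real.rpow_le_one_of_one_le_of_nonpos (by linarith [hA0 w]) (by linarith))
    have k3 : a₂ * (|f w| ^ q * (‖w.1‖ ^ (γ * q) * (1 + A w) ^ (-σ))) ≤
        a₂ * (|f w| ^ q * ‖w.1‖ ^ (γ * q)) := by gcongr
    have k4 : 0 ≤ γ * q * (|f w| ^ q * (‖w.1‖ ^ (γ * q) * (A w * (1 + A w) ^ (-σ - 1)))) := by
      have := hA0 w
      positivity
    have k5 : T w * (‖w.1‖ ^ (γ * q) * (1 + A w) ^ (-σ))
      + |f w| ^ q * (γ * q * (‖w.1‖ ^ (γ * q) * (1 + A w) ^ (-σ))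
        - γ * q * (‖w.1‖ ^ (γ * q) * (A w * (1 + A w) ^ (-σ - 1))))
      - P * (|f w| ^ q * (‖w.1‖ ^ (γ * q) * (A w ^ α * (1 + A w) ^ (-σ))))
      + Q * (|f w| ^ q * (‖w.1‖ ^ (γ * q) * (1 + A w) ^ (-σ))) ≤
      a₁ * gradSqG n m γ f w ^ (q / 2)
      + (2 * q * l⁻¹ - P) * (|f w| ^ q * (‖w.1‖ ^ (γ * q) * (A w ^ α * (1 + A w) ^ (-σ))))
      + a₂ * (|f w| ^ q * ‖w.1‖ ^ (γ * q)) := by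
      rw [ha₂] at k3 ⊢
      rw [ha₁]
      linarith
    have k6 := mul_le_mul_of_nonneg_right k5 (he0 w).le
    simp only [hu', hu, hg, hY, hX]
    linarith
  have hmono := integral_mono (hu'i.add (hui.const_mul Q))
    (((hgi.const_mul a₁).add (hYi.const_mul (2 * q * l⁻¹ - P))).add (hXi.const_mul a₂)) hpt
  rw [integral_add' hu'i (hui.const_mul Q), integral_const_mul, hu'eq,
    integral_add' ((hgi.const_mul a₁).add (hYi.const_mul (2 * q * l⁻¹ - P))) (hXi.const_mul a₂),
    integral_add' (hgi.const_mul a₁) (hYi.const_mul (2 * q * l⁻¹ - P)),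
    integral_const_mul, integral_const_mul, integral_const_mul] at hmono
  have hlP : 2 * q * l⁻¹ = P / 2 := by rw [hl]; field_simp; norm_num
  have hfin := integral_mono
    (integrable_abs_rpow_mul hf.continuous hfc hq0 ((hRc.mul hASc).mul hec))
    (hXi.add (hYi.const_mul (2 ^ σ))) (fun w => by
      have k1 := rpow_le_one_add (hA0 w) hσ0 hσα
      have k2 : |f w| ^ q * (‖w.1‖ ^ (γ * q) * A w ^ (α - σ) * e w) ≤
          |f w| ^ q * (‖w.1‖ ^ (γ * q) * (1 + 2 ^ σ * (A w ^ α * (1 + A w) ^ (-σ))) * e w) := by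
        have := (he0 w).le
        gcongr
      refine k2.trans (le_of_eq ?_)
      simp only [hX, hY, Pi.add_apply]
      ring)
  rw [integral_add' hXi (hYi.const_mul (2 ^ σ)), integral_const_mul] at hfin
  have hg0 : 0 ≤ ∫ w, g w := integral_nonneg fun w =>
    mul_nonneg (Real.rpow_nonneg (gradSqG_nonneg w) _) (he0 w).le
  have hX0 : 0 ≤ ∫ w, X w := integral_nonneg fun w => by
    have := (he0 w).le
    simp only [hX]; positivity
  rw [hlP] at hmono
  have hY1 : ∫ w, Y w ≤ 2 / P * (a₁ * ∫ w, g w) + 2 / P * (a₂ * ∫ w, X w) := by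
    rw [← mul_add, div_mul_eq_mul_div, le_div_iff₀ hP0]
    linarith
  have hY2 := mul_le_mul_of_nonneg_left hY1 (by positivity : (0 : ℝ) ≤ 2 ^ σ)
  have e1 : 0 ≤ 2 ^ σ * (2 / P) * (a₁ * ∫ w, X w) := by positivity
  have e2 : 0 ≤ 2 ^ σ * (2 / P) * (a₂ * ∫ w, g w) := by positivity
  refine hfin.trans ?_
  linarith

lemma hasDerivAt_exp_mul_add_rpow {b d c α : ℝ} (hb : 0 ≤ b) (hd : 0 ≤ d) :
    HasDerivAt (fun s : ℝ => (Real.exp (c * s) * b + d) ^ α)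
      (α * c * ((b + d) ^ (α - 1) * b)) 0 := by
  rcases (add_nonneg hb hd).eq_or_lt with h | h
  · have hb0 : b = 0 := by linarith
    have hd0 : d = 0 := by linarith
    simpa [hb0, hd0] using hasDerivAt_const (0 : ℝ) ((0 : ℝ) ^ α)
  · have := (((hasDerivAt_exp_mul_zero c).mul_const b).add_const d).rpow_const
      (p := α) (Or.inl (by simpa using h.ne'))
    refine this.congr_deriv ?_
    simp only [mul_zero, Real.exp_zero, one_mul]
    ring

/-- The Hardy inequality with smoothed weight `(|x|² + δ²)^{β/2}`. -/
theorem smoothed_hardy {q γ α β δ l : ℝ} (hq : 1 < q) (hγ : 0 < γ) (hα : 1 / 2 ≤ α)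
    (hβ : β = γ * (q - 1) - 1) (hβ0 : β ≤ 0) (hδ : 0 < δ) (hl : 0 < l)
    (hf : ContDiff ℝ (⊤ : ℕ∞) f) (hfc : HasCompactSupport f) :
    (n + β) * ∫ w, |f w| ^ q * ((‖w.1‖ ^ 2 + δ ^ 2) ^ (β / 2) *
        Real.exp (-gaugePow γ w ^ α)) ≤
      q * l ^ (q - 1) * (∫ w, (gradSqG n m γ f w) ^ (q / 2) * Real.exp (-gaugePow γ w ^ α)) +
      α * (2 + 2 * γ) * l ^ (q - 1) * (∫ w, |f w| ^ q * (‖w.1‖ ^ (γ * q) *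
        gaugePow γ w ^ ((α - 1 / 2) * q) * Real.exp (-gaugePow γ w ^ α))) +
      (q + α * (2 + 2 * γ)) * l⁻¹ *
        ∫ w, |f w| ^ q * (‖w.1‖ ^ (γ * q) * Real.exp (-gaugePow γ w ^ α)) := by
  have hq0 : 0 < q := by linarith
  have hq1 : 0 < q - 1 := by linarith
  have hα0 : 0 < α := by linarith
  have hγq : 0 < γ * q := by positivity
  set P := α * (2 + 2 * γ) with hP
  have hP0 : 0 < P := by positivity
  set A := fun w : EuclideanSpace ℝ (Fin n) × EuclideanSpace ℝ (Fin m) => gaugePow γ w with hA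
  have hA0 : ∀ w, 0 ≤ A w := gaugePow_nonneg
  have hbA : ∀ w, ‖w.1‖ ^ (2 + 2 * γ) ≤ A w := norm_fst_rpow_le_gaugePow
  set e := fun w => Real.exp (-A w ^ α) with he
  have he0 : ∀ w, 0 < e w := fun w => Real.exp_pos _
  have he1 : ∀ w, e w ≤ 1 := fun w =>
    Real.exp_le_one_iff.2 (neg_nonpos.2 (Real.rpow_nonneg (hA0 w) _))
  have hec : Continuous e := continuous_exp_neg_gaugePow_rpow hγ hα0.le
  have hRc : Continuous fun w : EuclideanSpace ℝ (Fin n) × EuclideanSpace ℝ (Fin m) =>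
    ‖w.1‖ ^ (γ * q) := continuous_norm_fst_rpow hγq.le
  have hbc : Continuous fun w : EuclideanSpace ℝ (Fin n) × EuclideanSpace ℝ (Fin m) =>
    ‖w.1‖ ^ (2 + 2 * γ) := continuous_norm_fst_rpow (by linarith)
  have hAc : Continuous A := continuous_gaugePow hγ
  have hAαc : Continuous fun w => A w ^ α := continuous_gaugePow_rpow hγ hα0.le
  have hASc : Continuous fun w => A w ^ ((α - 1 / 2) * q) :=
    continuous_gaugePow_rpow hγ (mul_nonneg (sub_nonneg.2 hα) hq0.le)
  have hfq : Continuous fun w => |f w| ^ q :=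
    hf.continuous.abs.rpow_const fun _ => Or.inr hq0.le
  set k := fun w : EuclideanSpace ℝ (Fin n) × EuclideanSpace ℝ (Fin m) =>
    (‖w.1‖ ^ 2 + δ ^ 2) ^ (β / 2) with hk
  have hkc : Continuous k := continuous_smoothed_norm_rpow hδ _
  set k' := fun w : EuclideanSpace ℝ (Fin n) × EuclideanSpace ℝ (Fin m) =>
    ‖w.1‖ ^ 2 * (‖w.1‖ ^ 2 + δ ^ 2) ^ (β / 2 - 1) with hk'
  have hkc' : Continuous k' :=
    (show Continuous fun w : EuclideanSpace ℝ (Fin n) × EuclideanSpace ℝ (Fin m) =>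
      ‖w.1‖ ^ 2 by fun_prop).mul (continuous_smoothed_norm_rpow hδ _)
  set D := fun w : EuclideanSpace ℝ (Fin n) × EuclideanSpace ℝ (Fin m) =>
    fderiv ℝ f w ((1 : ℝ) • w.1, (0 : ℝ) • w.2) with hD
  have hDc : Continuous D := (hf.continuous_fderiv (by simp)).clm_apply (by fun_prop)
  set T := fun w => q * |f w| ^ (q - 2) * f w * D w with hT
  have hTm : Measurable T := by
    have := hf.continuous.measurable
    have := hDc.measurable
    fun_prop
  have hTle : ∀ w, |T w| ≤ q * |f w| ^ (q - 1) * |D w| := fun w =>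
    abs_deriv_abs_rpow_le hq _ _
  set u := fun w => |f w| ^ q * (k w * e w) with hu
  set u' := fun w : EuclideanSpace ℝ (Fin n) × EuclideanSpace ℝ (Fin m) =>
    (T w * k w + |f w| ^ q * (β * k' w)
      - P * (|f w| ^ q * (k w * (A w ^ (α - 1) * ‖w.1‖ ^ (2 + 2 * γ))))) * e w with hu'
  set H := fun w : EuclideanSpace ℝ (Fin n) × EuclideanSpace ℝ (Fin m) =>
    |f w| ^ (q - 1) * (q * |D w| * k w + |f w| * ((-β + P * A w ^ α) * k w)) with hH
  have hk0 : ∀ w, 0 ≤ k w := fun w => by simp only [hk]; positivity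
  have hk0' : ∀ w, 0 ≤ k' w := fun w => by simp only [hk']; positivity
  have hkk : ∀ w, k' w ≤ k w := fun w => by
    have h1 : 0 < ‖w.1‖ ^ 2 + δ ^ 2 := by positivity
    simp only [hk, hk']
    rw [Real.rpow_sub_one h1.ne', ← mul_div_assoc, div_le_iff₀ h1, mul_comm]
    exact mul_le_mul_of_nonneg_left (le_add_of_nonneg_right (sq_nonneg δ))
      (Real.rpow_nonneg h1.le _)
  have hAb : ∀ w, A w ^ (α - 1) * ‖w.1‖ ^ (2 + 2 * γ) ≤ A w ^ α := fun w => by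
    calc _ ≤ A w ^ (α - 1) * A w :=
          mul_le_mul_of_nonneg_left (hbA w) (Real.rpow_nonneg (hA0 w) _)
      _ = A w ^ α := by
          rw [← Real.rpow_add_one' (hA0 w) (by simpa using hα0.ne')]; congr 1; ring
  have hbound : ∀ w, |u' w| ≤ H w := fun w => by
    have hAα0 : 0 ≤ A w ^ (α - 1) := Real.rpow_nonneg (hA0 w) _
    have hF0 : 0 ≤ |f w| ^ q := by positivity
    have hkw := hk0 w
    have hFq : |f w| ^ q = |f w| ^ (q - 1) * |f w| := by
      rw [← Real.rpow_add_one' (abs_nonneg _) (by linarith)]; congr 1; ring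
    have t1 : |T w * k w| ≤ q * |f w| ^ (q - 1) * |D w| * k w := by
      rw [abs_mul, abs_of_nonneg hkw]
      exact mul_le_mul_of_nonneg_right (hTle w) hkw
    have t2 : -β * (|f w| ^ q * k' w) ≤ -β * (|f w| ^ q * k w) :=
      mul_le_mul_of_nonneg_left (mul_le_mul_of_nonneg_left (hkk w) hF0) (by linarith)
    have t3 : 0 ≤ -β * (|f w| ^ q * k' w) :=
      mul_nonneg (by linarith) (mul_nonneg hF0 (hk0' w))
    have t4 : 0 ≤ P * (|f w| ^ q * (k w * (A w ^ (α - 1) * ‖w.1‖ ^ (2 + 2 * γ)))) := by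
      positivity
    have t5 : P * (|f w| ^ q * (k w * (A w ^ (α - 1) * ‖w.1‖ ^ (2 + 2 * γ)))) ≤
        P * (|f w| ^ q * (k w * A w ^ α)) := by
      gcongr; exact hAb w
    have hHe : H w = q * |f w| ^ (q - 1) * |D w| * k w + -β * (|f w| ^ q * k w) +
        P * (|f w| ^ q * (k w * A w ^ α)) := by
      simp only [hH]; rw [hFq]; ring
    rw [hHe]
    simp only [hu']
    rw [abs_mul, abs_of_pos (he0 w)]
    refine (mul_le_of_le_one_right (abs_nonneg _) (he1 w)).trans ?_
    rw [abs_le] at t1 ⊢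
    constructor <;> linarith [t1.1, t1.2]
  have hderiv : ∀ w : EuclideanSpace ℝ (Fin n) × EuclideanSpace ℝ (Fin m),
      HasDerivAt (fun s : ℝ => u (Real.exp (1 * s) • w.1, Real.exp (0 * s) • w.2))
        (u' w) 0 := fun w => by
    have d1 := hasDerivAt_abs_rpow_flow hf hq 1 0 w
    have h1 : 0 < ‖w.1‖ ^ 2 + δ ^ 2 := by positivity
    have d2 := (((hasDerivAt_exp_mul_zero 2).mul_const (‖w.1‖ ^ 2)).add_const
      (δ ^ 2)).rpow_const (p := β / 2) (Or.inl (by simpa using h1.ne'))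
    have d3 := (hasDerivAt_exp_mul_add_rpow (α := α) (b := ‖w.1‖ ^ (2 + 2 * γ))
      (d := (1 + γ) ^ 2 * ‖w.2‖ ^ 2) (c := 2 + 2 * γ) (by positivity) (by positivity)).neg.exp
    have d := d1.mul (d2.mul d3)
    have hfun : (fun s : ℝ => u (Real.exp (1 * s) • w.1, Real.exp (0 * s) • w.2)) =
        fun s : ℝ => |f (Real.exp (1 * s) • w.1, Real.exp (0 * s) • w.2)| ^ q *
          ((Real.exp (2 * s) * ‖w.1‖ ^ 2 + δ ^ 2) ^ (β / 2) *
            Real.exp (-(Real.exp ((2 + 2 * γ) * s) * ‖w.1‖ ^ (2 + 2 * γ) +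
              (1 + γ) ^ 2 * ‖w.2‖ ^ 2) ^ α)) := by
      funext s
      simp only [hu, hk, he, hA, gaugePow]
      rw [norm_smul, Real.norm_eq_abs, Real.abs_exp, zero_mul, Real.exp_zero, one_smul,
        Real.mul_rpow (Real.exp_pos _).le (norm_nonneg _), ← Real.exp_mul, mul_pow,
        ← Real.exp_nat_mul]
      push_cast
      ring_nf
    rw [hfun]
    refine d.congr_deriv ?_
    simp only [hu', hT, hD, he, hk, hk', hA, gaugePow, Pi.mul_apply, Pi.neg_apply, mul_zero,
      Real.exp_zero, one_mul, one_smul, zero_smul, Prod.mk.eta, hP]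
    ring
  obtain ⟨hu'i, hu'eq⟩ := integral_deriv_flow (n := n) (m := m) 1 0 (u := u) (u' := u')
    (H := H) (hfq.mul (hkc.mul hec)) (hasCompactSupport_abs_rpow_mul hfc hq0 _)
    (by
      have h1 := hbc.measurable
      have h2 := hkc.measurable
      have h3 := hkc'.measurable
      have h4 := hAc.measurable
      have h5 := hfq.measurable
      have h6 := hec.measurable
      simp only [hu']
      fun_prop)
    (((hf.continuous.abs.rpow_const fun _ => Or.inr hq1.le)).mul
      (((continuous_const.mul hDc.abs).mul hkc).add
        (hf.continuous.abs.mul ((continuous_const.add (continuous_const.mul hAαc)).mul hkc))))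
    (hasCompactSupport_abs_rpow_mul hfc hq1 _) hbound hderiv
  have hui : Integrable u := integrable_abs_rpow_mul hf.continuous hfc hq0 (hkc.mul hec)
  set S := fun w : EuclideanSpace ℝ (Fin n) × EuclideanSpace ℝ (Fin m) =>
    |f w| ^ q * (‖w.1‖ ^ (γ * q) * A w ^ ((α - 1 / 2) * q) * e w) with hS
  set X := fun w : EuclideanSpace ℝ (Fin n) × EuclideanSpace ℝ (Fin m) =>
    |f w| ^ q * (‖w.1‖ ^ (γ * q) * e w) with hX
  set g := fun w => gradSqG n m γ f w ^ (q / 2) * e w with hg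
  have hSi : Integrable S :=
    integrable_abs_rpow_mul hf.continuous hfc hq0 ((hRc.mul hASc).mul hec)
  have hXi : Integrable X := integrable_abs_rpow_mul hf.continuous hfc hq0 (hRc.mul hec)
  have hgi : Integrable g := by
    refine Continuous.integrable_of_hasCompactSupport
      (((continuous_gradSqG hγ hf).rpow_const fun _ => Or.inr (by linarith)).mul hec) ?_
    exact ((hasCompactSupport_gradSqG hfc).comp_left (g := fun t : ℝ => t ^ (q / 2))
      (Real.zero_rpow (by linarith))).mul_right
  have hpt : ∀ w, (β * u w - u' w) ≤
      q * l ^ (q - 1) * g w + P * l ^ (q - 1) * S w + (q + P) * l⁻¹ * X w := fun w => by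
    have hG : √(gradSqG n m γ f w) ^ q = gradSqG n m γ f w ^ (q / 2) := by
      rw [Real.sqrt_eq_rpow, ← Real.rpow_mul (gradSqG_nonneg w)]; congr 1; ring
    have hTr : |T w| ≤ q * |f w| ^ (q - 1) * (‖w.1‖ * √(gradSqG n m γ f w)) :=
      (hTle w).trans (mul_le_mul_of_nonneg_left
        (by simpa [hD] using abs_fderiv_fst_le (γ := γ) (f := f) w) (by positivity))
    have k1 := hardy_pointwise (α := α) (N := (n : ℝ)) (norm_nonneg w.1) (hbA w) (abs_nonneg _)
      (Real.sqrt_nonneg (gradSqG n m γ f w)) hTr hδ hγ hq hβ hβ0 hP0.le hl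
    rw [hG] at k1
    have k2 := mul_le_mul_of_nonneg_right k1 (he0 w).le
    simp only [hu', hu, hg, hS, hX, hk, hk']
    linarith
  have hmono := integral_mono ((hui.const_mul β).sub hu'i)
    (((hgi.const_mul (q * l ^ (q - 1))).add (hSi.const_mul (P * l ^ (q - 1)))).add
      (hXi.const_mul ((q + P) * l⁻¹))) hpt
  rw [integral_sub' (hui.const_mul β) hu'i, integral_const_mul, hu'eq,
    integral_add' ((hgi.const_mul _).add (hSi.const_mul _)) (hXi.const_mul _),
    integral_add' (hgi.const_mul _) (hSi.const_mul _),
    integral_const_mul, integral_const_mul, integral_const_mul] at hmono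
  linarith

lemma hardy_rpow_exp (n m : ℕ) {q γ α : ℝ} (hq : q ∈ Set.Ioo (1 : ℝ) 2) (hγ : 0 < γ)
    (hα : α = q / (q - 1) / (2 + 2 * γ)) (hγq : γ * (q - 1) ≤ 1)
    (hdim : 0 < (n : ℝ) + γ * (q - 1) - 1) :
    ∃ C > 0, ∀ ε : ℝ, ε ∈ Set.Ioc (0 : ℝ) 1 →
      ∀ f : EuclideanSpace ℝ (Fin n) × EuclideanSpace ℝ (Fin m) → ℝ,
      ContDiff ℝ (⊤ : ℕ∞) f → HasCompactSupport f →
      ∫ w, |f w| ^ q * Real.exp (-gaugePow γ w ^ α) ≤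
        C * (ε * (∫ w, (gradSqG n m γ f w) ^ (q / 2) * Real.exp (-gaugePow γ w ^ α)) +
          ε ^ (-γ) * ∫ w, |f w| ^ q * (‖w.1‖ ^ (γ * q) * Real.exp (-gaugePow γ w ^ α))) := by
  obtain ⟨hq1, -⟩ := hq
  have hq0 : 0 < q := by linarith
  have hq1' : 0 < q - 1 := by linarith
  have hc : 0 < 2 + 2 * γ := by linarith
  have hα2 : 1 / 2 ≤ α := by
    rw [hα, div_div, div_le_div_iff₀ two_pos (by positivity)]; nlinarith
  have hα0 : 0 < α := by linarith
  set σ := γ * q / (2 + 2 * γ) with hσ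
  have hασ : (α - 1 / 2) * q = α - σ := by rw [hα, hσ]; field_simp; ring
  have hσα : σ ≤ α := by
    have : 0 ≤ (α - 1 / 2) * q := mul_nonneg (by linarith) hq0.le
    linarith
  set β := γ * (q - 1) - 1 with hβ
  have hβ0 : β ≤ 0 := by linarith
  have hnβ : 0 < n + β := by linarith
  obtain ⟨C, hC, hbound⟩ := exists_weighted_bound n m hq1 hγ hα hσ hσα
  set P := α * (2 + 2 * γ) with hP
  have hP0 : 0 < P := by positivity
  set K : ℝ := 2 ^ (-(β / 2)) with hK
  have hK0 : 0 < K := by positivity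
  refine ⟨K * ((q + P + P * C) / (n + β)) + 1, by positivity, fun ε ⟨hε0, hε1⟩ f hf hfc => ?_⟩
  set δ := ε ^ (1 / q) with hδ
  have hδ0 : 0 < δ := by positivity
  have hδ1 : δ ≤ 1 := Real.rpow_le_one hε0.le hε1 (by positivity)
  have hδq : δ ^ q = ε := by
    rw [hδ, ← Real.rpow_mul hε0.le, one_div_mul_cancel hq0.ne', Real.rpow_one]
  have hδγ : δ ^ (-(γ * q)) = ε ^ (-γ) := by
    rw [← hδq, ← Real.rpow_mul hδ0.le]; congr 1; ring
  set l := δ ^ (1 + γ) with hl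
  have hl0 : 0 < l := by positivity
  have hl1 : l ≤ 1 := Real.rpow_le_one hδ0.le hδ1 (by linarith)
  have hDL : δ ^ (-β) * l ^ (q - 1) = ε := by
    rw [← hδq, hl, ← Real.rpow_mul hδ0.le, ← Real.rpow_add hδ0]; congr 1; rw [hβ]; ring
  have hDl : δ ^ (-β) * l⁻¹ = ε ^ (-γ) := by
    rw [← hδγ, hl, ← Real.rpow_neg hδ0.le, ← Real.rpow_add hδ0]; congr 1; rw [hβ]; ring
  have hεE : ε ≤ ε ^ (-γ) :=
    hε1.trans (Real.one_le_rpow_of_pos_of_le_one_of_nonpos hε0 hε1 (by linarith))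
  have hS := hbound f hf hfc
  have hH := smoothed_hardy (n := n) (m := m) (α := α) hq1 hγ hα2 hβ hβ0 hδ0 hl0 hf hfc
  rw [hασ] at hH
  have hec := continuous_exp_neg_gaugePow_rpow (n := n) (m := m) hγ hα0.le
  have hXi : Integrable fun w => |f w| ^ q * (‖w.1‖ ^ (γ * q) *
      Real.exp (-gaugePow γ w ^ α)) := integrable_abs_rpow_mul hf.continuous hfc hq0
    ((continuous_norm_fst_rpow (n := n) (m := m) (mul_pos hγ hq0).le).mul hec)
  have hHi : Integrable fun w => |f w| ^ q * ((‖w.1‖ ^ 2 + δ ^ 2) ^ (β / 2) *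
      Real.exp (-gaugePow γ w ^ α)) := integrable_abs_rpow_mul hf.continuous hfc hq0
    ((continuous_smoothed_norm_rpow (n := n) (m := m) hδ0 (β / 2)).mul hec)
  have h0 := integral_mono (integrable_abs_rpow_mul hf.continuous hfc hq0 hec)
    ((hHi.const_mul (K * δ ^ (-β))).add (hXi.const_mul (δ ^ (-(γ * q))))) fun w => by
      have h := mul_le_mul_of_nonneg_right (le_smoothed_add (norm_nonneg w.1) (abs_nonneg (f w))
        hδ0 hγ hq1 hβ0) (Real.exp_pos (-gaugePow γ w ^ α)).le
      rw [← hK] at h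
      simp only [Pi.add_apply]
      linarith
  rw [integral_add' (hHi.const_mul _) (hXi.const_mul _), integral_const_mul,
    integral_const_mul, hδγ] at h0
  have hX0 : 0 ≤ ∫ w, |f w| ^ q * (‖w.1‖ ^ (γ * q) * Real.exp (-gaugePow γ w ^ α)) :=
    integral_nonneg fun w => by positivity
  have hG0 : 0 ≤ ∫ w, (gradSqG n m γ f w) ^ (q / 2) * Real.exp (-gaugePow γ w ^ α) :=
    integral_nonneg fun w =>
      mul_nonneg (Real.rpow_nonneg (gradSqG_nonneg w) _) (Real.exp_pos _).le
  generalize (∫ w, |f w| ^ q * (‖w.1‖ ^ (γ * q) * Real.exp (-gaugePow γ w ^ α))) = X at *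
  generalize (∫ w, (gradSqG n m γ f w) ^ (q / 2) * Real.exp (-gaugePow γ w ^ α)) = G at *
  generalize (∫ w, |f w| ^ q * ((‖w.1‖ ^ 2 + δ ^ 2) ^ (β / 2) *
    Real.exp (-gaugePow γ w ^ α))) = H at *
  generalize (∫ w, |f w| ^ q * (‖w.1‖ ^ (γ * q) * gaugePow γ w ^ (α - σ) *
    Real.exp (-gaugePow γ w ^ α))) = S at *
  have hE0 : 0 < ε ^ (-γ) := by positivity
  have hD0 : 0 < δ ^ (-β) := by positivity
  have hDH : (n + β) * (δ ^ (-β) * H) ≤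
      (q + P + P * C) * (ε * G + ε ^ (-γ) * X) := by
    calc (n + β) * (δ ^ (-β) * H) = δ ^ (-β) * ((n + β) * H) := by ring
      _ ≤ δ ^ (-β) * (q * l ^ (q - 1) * G + P * l ^ (q - 1) * S + (q + P) * l⁻¹ * X) := by
          gcongr
      _ = q * (δ ^ (-β) * l ^ (q - 1)) * G + P * (δ ^ (-β) * l ^ (q - 1)) * S +
          (q + P) * (δ ^ (-β) * l⁻¹) * X := by ring
      _ = q * ε * G + P * ε * S + (q + P) * ε ^ (-γ) * X := by rw [hDL, hDl]
      _ ≤ q * ε * G + P * ε * (C * (G + X)) + (q + P) * ε ^ (-γ) * X := by gcongr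
      _ = (q + P * C) * ε * G + P * C * (ε * X) + (q + P) * ε ^ (-γ) * X := by ring
      _ ≤ (q + P * C + P) * ε * G + P * C * (ε ^ (-γ) * X) + (q + P) * ε ^ (-γ) * X := by
          have h1 : P * C * (ε * X) ≤ P * C * (ε ^ (-γ) * X) := by gcongr
          have h2 : 0 ≤ P * (ε * G) := by positivity
          linarith
      _ = _ := by ring
  have hDH' : δ ^ (-β) * H ≤ (q + P + P * C) / (n + β) * (ε * G + ε ^ (-γ) * X) := by
    rw [div_mul_eq_mul_div, le_div_iff₀ hnβ]; linarith
  have hKH := mul_le_mul_of_nonneg_left hDH' hK0.le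
  have : 0 ≤ ε * G := by positivity
  linarith

lemma integral_muG (hγ : 0 < γ) {p : ℝ} (hp : 0 ≤ p)
    (g : EuclideanSpace ℝ (Fin n) × EuclideanSpace ℝ (Fin m) → ℝ) :
    ∫ w, g w ∂(muG n m γ p) =
      (∫ v : EuclideanSpace ℝ (Fin n) × EuclideanSpace ℝ (Fin m),
        Real.exp (-(GKaplan n m γ v) ^ p))⁻¹ *
      ∫ w, g w * Real.exp (-gaugePow γ w ^ (p / (2 + 2 * γ))) := by
  have hZ : 0 ≤ (∫ v : EuclideanSpace ℝ (Fin n) × EuclideanSpace ℝ (Fin m),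
      Real.exp (-(GKaplan n m γ v) ^ p))⁻¹ :=
    inv_nonneg.2 (integral_nonneg fun _ => (Real.exp_pos _).le)
  have hec := continuous_exp_neg_gaugePow_rpow (n := n) (m := m) hγ
    (show 0 ≤ p / (2 + 2 * γ) by positivity)
  unfold muG
  rw [integral_withDensity_eq_integral_toReal_smul
    (by simp only [GKaplan_rpow]; exact (hec.measurable.const_mul _).ennreal_ofReal)
    (Filter.Eventually.of_forall fun _ => ENNReal.ofReal_lt_top), ← integral_const_mul]
  refine integral_congr_ae (Filter.Eventually.of_forall fun w => ?_)
  simp only [smul_eq_mul]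
  rw [ENNReal.toReal_ofReal (mul_nonneg hZ (Real.exp_pos _).le), GKaplan_rpow p w]
  ring

end Grushin

/-- Dimension-free Hardy-type inequality in the Grushin setting for
`dμ = Z⁻¹ e^{-N^p} dξ`, `q ∈ (1,2)`, `p = q/(q-1)`, `γ > 0` with `γ(q-1) ≤ 1`
and `n + γ(q-1) - 1 > 0`:
`∫ |f|^q dμ ≤ C(ε ∫ |∇_γ f|^q dμ + ε^{-γ} ∫ |x|^{γq} |f|^q dμ)` for all `ε ∈ (0,1]`. -/
theorem hardy_Lq_grushin_eps (n m : ℕ) (hn : 1 ≤ n) (hm : 1 ≤ m) (q p γ : ℝ)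
    (hq : q ∈ Set.Ioo (1 : ℝ) 2) (hp : p = q / (q - 1)) (hγ : 0 < γ)
    (hγq : γ * (q - 1) ≤ 1) (hdim : 0 < (n : ℝ) + γ * (q - 1) - 1) :
    ∃ C > 0, ∀ ε : ℝ, ε ∈ Set.Ioc (0 : ℝ) 1 →
      ∀ f : EuclideanSpace ℝ (Fin n) × EuclideanSpace ℝ (Fin m) → ℝ,
      ContDiff ℝ (⊤ : ℕ∞) f → HasCompactSupport f →
      ∫ w, |f w| ^ q ∂(muG n m γ p) ≤
        C * (ε * (∫ w, (gradSqG n m γ f w) ^ (q / 2) ∂(muG n m γ p)) +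
             ε ^ (-γ) * (∫ w, ‖w.1‖ ^ (γ * q) * |f w| ^ q ∂(muG n m γ p))) := by
  have hq0 : 0 < q := by linarith [hq.1]
  have hp0 : 0 ≤ p := hp ▸ div_nonneg hq0.le (by linarith [hq.1])
  obtain ⟨C, hC, h⟩ := hardy_rpow_exp n m (α := p / (2 + 2 * γ)) hq hγ (by rw [hp]) hγq hdim
  refine ⟨C, hC, fun ε hε f hf hfc => ?_⟩
  rw [integral_muG hγ hp0, integral_muG hγ hp0, integral_muG hγ hp0]
  have hZ : 0 ≤ (∫ v : EuclideanSpace ℝ (Fin n) × EuclideanSpace ℝ (Fin m),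
      Real.exp (-(GKaplan n m γ v) ^ p))⁻¹ :=
    inv_nonneg.2 (integral_nonneg fun _ => (Real.exp_pos _).le)
  have hX : ∀ w : EuclideanSpace ℝ (Fin n) × EuclideanSpace ℝ (Fin m),
      ‖w.1‖ ^ (γ * q) * |f w| ^ q * Real.exp (-gaugePow γ w ^ (p / (2 + 2 * γ))) =
      |f w| ^ q * (‖w.1‖ ^ (γ * q) * Real.exp (-gaugePow γ w ^ (p / (2 + 2 * γ)))) :=
    fun w => by ring
  simp only [hX]
  have := mul_le_mul_of_nonneg_left (h ε hε f hf hfc) hZ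
  linarith
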